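/- For the thermal fermionic XX model with parameters a ∈ ℝ, b > 0 satisfying |a| > 2b (the gapped phase), and for every Renyi index α > 0, the asymptotically exact mutual information decays exponentially in the inverse temperature: for every κ < (|a| − 2b)·min{α,1}, lim_{β→∞} e^{κβ} I_{α,∞}(β) = 0. -/

import Mathlib

open Real Filter MeasureTheory

/-- Renyi-α covariance entropy function (von-Neumann entropy for `α = 1`). -/
noncomputable def sFun (α x : ℝ) : ℝ :=
  if α = 1 then
    -(((1 + x) / 2) * Real.logb 2 ((1 + x) / 2)) - ((1 - x) / 2) * Real.logb 2 ((1 - x) / 2)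
  else (1 / (1 - α)) * Real.logb 2 (((1 + x) / 2) ^ α + ((1 - x) / 2) ^ α)

/-- Difference quotient of `g`, extended by the derivative on the diagonal. -/
noncomputable def dq (g : ℝ → ℝ) (u v : ℝ) : ℝ :=
  if u = v then deriv g u else (g u - g v) / (u - v)

/-- The symbol of the thermal fermionic XX chain: `λ_β(θ) = -tanh(β(a/2 + b cos θ))`. -/
noncomputable def lamXX (β a b θ : ℝ) : ℝ := - Real.tanh (β * (a / 2 + b * Real.cos θ))

/-- The asymptotically exact Renyi-α mutual information of the bisected thermal XX chain. -/
noncomputable def IalphaInf (α a b β : ℝ) : ℝ :=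
  (1 / (4 * π ^ 2)) * ∫ φ in (-π)..π, ∫ θ in (-π)..π,
    dq (sFun α) (lamXX β a b θ) (lamXX β a b φ) *
      ((deriv (lamXX β a b) φ - deriv (lamXX β a b) θ) / Real.tan ((φ - θ) / 2))

lemma hasDerivAt_tanh (x : ℝ) : HasDerivAt Real.tanh (1 - Real.tanh x ^ 2) x := by
  have hc : Real.cosh x ≠ 0 := (Real.cosh_pos x).ne'
  have h := (Real.hasDerivAt_sinh x).div (Real.hasDerivAt_cosh x) hc
  have hfun : Real.tanh = fun y => Real.sinh y / Real.cosh y :=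
    funext Real.tanh_eq_sinh_div_cosh
  rw [hfun]
  refine h.congr_deriv ?_
  field_simp

lemma one_sub_tanh_sq_le (x : ℝ) : 1 - Real.tanh x ^ 2 ≤ 4 * Real.exp (-(2 * |x|)) := by
  have hc : 0 < Real.cosh x := Real.cosh_pos x
  have h1 : 1 - Real.tanh x ^ 2 = 1 / Real.cosh x ^ 2 := by
    rw [Real.tanh_eq_sinh_div_cosh]
    field_simp
    linarith [Real.cosh_sq x]
  have h2 : Real.exp |x| ≤ 2 * Real.cosh x := by
    rw [← Real.cosh_abs, Real.cosh_eq]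
    linarith [Real.exp_pos (-|x|)]
  have h3 : Real.exp (-(2 * |x|)) = 1 / Real.exp |x| ^ 2 := by
    rw [Real.exp_neg, ← Real.exp_nat_mul]
    norm_num
  rw [h1, h3, mul_one_div, div_le_div_iff₀ (by positivity) (by positivity)]
  have := pow_le_pow_left₀ (Real.exp_pos |x|).le h2 2
  linarith

lemma two_rpow_neg_le_rpow_add_rpow {α p q : ℝ} (hα : 0 < α) (hp : 0 < p) (hq : 0 < q)
    (hpq : p + q = 1) : (1 / 2 : ℝ) ^ α ≤ p ^ α + q ^ α := by
  rcases le_total (1 / 2) p with h | h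
  · linarith [Real.rpow_le_rpow (by norm_num) h hα.le, Real.rpow_pos_of_pos hq α]
  · linarith [Real.rpow_le_rpow (by norm_num) (by linarith : 1 / 2 ≤ q) hα.le,
      Real.rpow_pos_of_pos hp α]

lemma rpow_le_mul_rpow {p q γ δ : ℝ} (hp : 0 < p) (hq : 0 < q) (hp1 : p ≤ 1) (hq1 : q ≤ 1)
    (hγδ : γ ≤ δ) (hγ : γ ≤ 0) : p ^ δ ≤ (p * q) ^ γ :=
  (Real.rpow_le_rpow_of_exponent_ge hp hp1 hγδ).trans
    (Real.rpow_le_rpow_of_nonpos (mul_pos hp hq) (mul_le_of_le_one_right hp.le hq1) hγ)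

lemma abs_log_le_mul_rpow {p q γ : ℝ} (hp : 0 < p) (hq : 0 < q) (hp1 : p ≤ 1) (hq1 : q ≤ 1)
    (hγ : γ < 1) : |Real.log p| ≤ (p * q) ^ (γ - 1) / (1 - γ) := by
  have h := Real.log_le_rpow_div (inv_pos.2 hp).le (by linarith : 0 < 1 - γ)
  rw [Real.log_inv, Real.inv_rpow hp.le, ← Real.rpow_neg hp.le, neg_sub] at h
  rw [abs_of_nonpos (Real.log_nonpos hp.le hp1)]
  refine h.trans ?_
  exact div_le_div_of_nonneg_right (rpow_le_mul_rpow hp hq hp1 hq1 le_rfl (by linarith))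
    (by linarith)

lemma hasDerivAt_sFun_one {x : ℝ} (hp : 0 < (1 + x) / 2) (hq : 0 < (1 - x) / 2) :
    HasDerivAt (sFun 1)
      (-(Real.log ((1 + x) / 2) - Real.log ((1 - x) / 2)) / (2 * Real.log 2)) x := by
  have hl : Real.log 2 ≠ 0 := (Real.log_pos one_lt_two).ne'
  have hP : HasDerivAt (fun y : ℝ => (1 + y) / 2) (1 / 2) x :=
    ((hasDerivAt_id x).const_add 1).div_const 2
  have hQ : HasDerivAt (fun y : ℝ => (1 - y) / 2) (-1 / 2) x :=
    ((hasDerivAt_id x).const_sub 1).div_const 2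
  have h := ((hP.mul ((hP.log hp.ne').div_const (Real.log 2))).neg).sub
    (hQ.mul ((hQ.log hq.ne').div_const (Real.log 2)))
  have hfun : sFun 1 = fun y => -(((1 + y) / 2) * (Real.log ((1 + y) / 2) / Real.log 2)) -
      ((1 - y) / 2) * (Real.log ((1 - y) / 2) / Real.log 2) := by
    funext y
    simp [sFun, Real.logb]
  rw [hfun]
  refine h.congr_deriv ?_
  have h1 : (1 + x) ≠ 0 := by linarith
  have h2 : (1 - x) ≠ 0 := by linarith
  field_simp
  ring

lemma hasDerivAt_sFun_of_ne_one {α x : ℝ} (hα : α ≠ 1)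
    (hp : 0 < (1 + x) / 2) (hq : 0 < (1 - x) / 2) :
    HasDerivAt (sFun α)
      (α / ((1 - α) * (2 * Real.log 2)) *
        ((((1 + x) / 2) ^ (α - 1) - ((1 - x) / 2) ^ (α - 1)) /
          (((1 + x) / 2) ^ α + ((1 - x) / 2) ^ α))) x := by
  have hl : Real.log 2 ≠ 0 := (Real.log_pos one_lt_two).ne'
  have hP : HasDerivAt (fun y : ℝ => (1 + y) / 2) (1 / 2) x :=
    ((hasDerivAt_id x).const_add 1).div_const 2
  have hQ : HasDerivAt (fun y : ℝ => (1 - y) / 2) (-1 / 2) x :=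
    ((hasDerivAt_id x).const_sub 1).div_const 2
  have hs : 0 < ((1 + x) / 2) ^ α + ((1 - x) / 2) ^ α :=
    add_pos (Real.rpow_pos_of_pos hp α) (Real.rpow_pos_of_pos hq α)
  have h := ((((hP.rpow_const (p := α) (Or.inl hp.ne')).add
    (hQ.rpow_const (p := α) (Or.inl hq.ne'))).log hs.ne').div_const (Real.log 2)).const_mul
    (1 / (1 - α))
  have hfun : sFun α = fun y => 1 / (1 - α) *
      (Real.log (((1 + y) / 2) ^ α + ((1 - y) / 2) ^ α) / Real.log 2) := by
    funext y
    simp [sFun, Real.logb, hα]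
  rw [hfun]
  refine h.congr_deriv ?_
  have h1 : (1 - α) ≠ 0 := sub_ne_zero.2 hα.symm
  simp only [Pi.add_apply]
  generalize ((1 + x) / 2) ^ α + ((1 - x) / 2) ^ α = s at hs ⊢
  generalize ((1 + x) / 2) ^ (α - 1) = y
  generalize ((1 - x) / 2) ^ (α - 1) = z
  have hs' := hs.ne'
  field_simp
  ring

/-- The derivative of the entropy function blows up at `±1` at most like `(1 - x ^ 2) ^ (γ - 1)`
for every `γ < min α 1`. -/
lemma exists_deriv_sFun_bound {α γ : ℝ} (hα : 0 < α) (hγα : γ ≤ α) (hγ : γ < 1) :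
    ∃ K : ℝ, 0 ≤ K ∧ ∀ x ∈ Set.Ioo (-1 : ℝ) 1, DifferentiableAt ℝ (sFun α) x ∧
      |deriv (sFun α) x| ≤ K * (1 - x ^ 2) ^ (γ - 1) := by
  have hl : 0 < Real.log 2 := Real.log_pos one_lt_two
  have h1γ : 0 < 1 - γ := by linarith
  suffices h : ∃ K : ℝ, 0 ≤ K ∧ ∀ x ∈ Set.Ioo (-1 : ℝ) 1, ∃ d, HasDerivAt (sFun α) d x ∧
      |d| ≤ K * ((1 + x) / 2 * ((1 - x) / 2)) ^ (γ - 1) by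
    obtain ⟨K, hK, h⟩ := h
    refine ⟨K * (1 / 4) ^ (γ - 1), by positivity, fun x hx => ?_⟩
    obtain ⟨d, hd, hb⟩ := h x hx
    refine ⟨hd.differentiableAt, ?_⟩
    rw [hd.deriv, mul_assoc, ← Real.mul_rpow (by norm_num) (by nlinarith [hx.1, hx.2])]
    convert hb using 3
    ring
  by_cases h1 : α = 1
  · subst h1
    refine ⟨1 / ((1 - γ) * Real.log 2), by positivity, fun x hx => ?_⟩
    have hp : 0 < (1 + x) / 2 := by linarith [hx.1]
    have hq : 0 < (1 - x) / 2 := by linarith [hx.2]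
    refine ⟨_, hasDerivAt_sFun_one hp hq, ?_⟩
    have hp1 : (1 + x) / 2 ≤ 1 := by linarith
    have hq1 : (1 - x) / 2 ≤ 1 := by linarith
    have e1 := abs_log_le_mul_rpow hp hq hp1 hq1 hγ
    have e2 := abs_log_le_mul_rpow hq hp hq1 hp1 hγ
    rw [mul_comm ((1 - x) / 2)] at e2
    rw [abs_div, abs_neg, abs_of_pos (by positivity : 0 < 2 * Real.log 2),
      div_le_iff₀ (by positivity)]
    calc _ ≤ _ := abs_sub _ _
      _ ≤ _ := add_le_add e1 e2
      _ = _ := by field_simp; ring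
  · refine ⟨|α / ((1 - α) * (2 * Real.log 2))| * (2 / (1 / 2) ^ α), by positivity,
      fun x hx => ?_⟩
    have hp : 0 < (1 + x) / 2 := by linarith [hx.1]
    have hq : 0 < (1 - x) / 2 := by linarith [hx.2]
    refine ⟨_, hasDerivAt_sFun_of_ne_one h1 hp hq, ?_⟩
    have hp1 : (1 + x) / 2 ≤ 1 := by linarith
    have hq1 : (1 - x) / 2 ≤ 1 := by linarith
    have e1 := rpow_le_mul_rpow hp hq hp1 hq1
      (by linarith : γ - 1 ≤ α - 1) (by linarith)
    have e2 := rpow_le_mul_rpow hq hp hq1 hp1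
      (by linarith : γ - 1 ≤ α - 1) (by linarith)
    rw [mul_comm ((1 - x) / 2)] at e2
    have e3 := two_rpow_neg_le_rpow_add_rpow hα hp hq (by ring)
    have hc : (0 : ℝ) < (1 / 2) ^ α := by positivity
    rw [abs_mul, mul_assoc, abs_div (_ - _), abs_of_pos (hc.trans_le e3), div_mul_eq_mul_div]
    gcongr
    calc _ ≤ _ := abs_sub _ _
      _ = _ := by rw [abs_of_pos (Real.rpow_pos_of_pos hp _),
                    abs_of_pos (Real.rpow_pos_of_pos hq _)]
      _ ≤ _ := add_le_add e1 e2
      _ = _ := by ring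

lemma abs_dq_le {g : ℝ → ℝ} {K γ u v w : ℝ} (hK : 0 ≤ K) (hγ : γ < 1)
    (hg : ∀ x ∈ Set.Ioo (-1 : ℝ) 1, DifferentiableAt ℝ g x ∧
      |deriv g x| ≤ K * (1 - x ^ 2) ^ (γ - 1))
    (hw : 0 < w) (hu : w ≤ 1 - u ^ 2) (hv : w ≤ 1 - v ^ 2) :
    |dq g u v| ≤ K * w ^ (γ - 1) := by
  have key : ∀ x, w ≤ 1 - x ^ 2 → DifferentiableAt ℝ g x ∧ |deriv g x| ≤ K * w ^ (γ - 1) := by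
    intro x hx
    obtain ⟨h1, h2⟩ := hg x (abs_lt.1 ((sq_lt_one_iff_abs_lt_one x).1 (by linarith)))
    exact ⟨h1, h2.trans (mul_le_mul_of_nonneg_left
      (Real.rpow_le_rpow_of_nonpos hw hx (by linarith)) hK)⟩
  unfold dq
  split_ifs with huv
  · exact (key u hu).2
  have hmem : ∀ x ∈ Set.uIcc v u, w ≤ 1 - x ^ 2 := by
    intro x hx
    rcases le_total v u with h | h
    · rw [Set.uIcc_of_le h] at hx
      rcases le_total 0 x with h0 | h0 <;> nlinarith [hx.1, hx.2]
    · rw [Set.uIcc_of_ge h] at hx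
      rcases le_total 0 x with h0 | h0 <;> nlinarith [hx.1, hx.2]
  have h := (convex_uIcc v u).norm_image_sub_le_of_norm_deriv_le (f := g) (C := K * w ^ (γ - 1))
    (fun x hx => (key x (hmem x hx)).1) (fun x hx => (key x (hmem x hx)).2)
    Set.left_mem_uIcc Set.right_mem_uIcc
  rw [abs_div, div_le_iff₀ (abs_pos.2 (sub_ne_zero.2 huv))]
  exact h

lemma abs_dq_mul_sub (g : ℝ → ℝ) (u v : ℝ) : |dq g u v * (u - v)| = |g u - g v| := by
  unfold dq
  split_ifs with h
  · simp [h]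
  · rw [div_mul_cancel₀ _ (sub_ne_zero.2 h)]

lemma hasDerivAt_lamXX (β a b θ : ℝ) :
    HasDerivAt (lamXX β a b) (β * b * (Real.sin θ * (1 - lamXX β a b θ ^ 2))) θ := by
  have h1 : HasDerivAt (fun t : ℝ => β * (a / 2 + b * Real.cos t)) (β * (b * -Real.sin θ)) θ :=
    (((Real.hasDerivAt_cos θ).const_mul b).const_add (a / 2)).const_mul β
  have h := ((hasDerivAt_tanh (β * (a / 2 + b * Real.cos θ))).comp θ h1).neg
  refine h.congr_deriv ?_
  simp only [lamXX]
  ring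

lemma one_sub_tanh_sq_le_of_gapped {β a b t : ℝ} (hβ : 0 ≤ β) (hb : 0 < b)
    (ht : t ∈ Set.Icc (-1 : ℝ) 1) :
    1 - Real.tanh (β * (a / 2 + b * t)) ^ 2 ≤ 4 * Real.exp (-(β * (|a| - 2 * b))) := by
  refine (one_sub_tanh_sq_le _).trans ?_
  rw [abs_mul, abs_of_nonneg hβ]
  have h1 : |b * t| ≤ b := by
    rw [abs_mul, abs_of_pos hb]
    exact mul_le_of_le_one_right hb.le (abs_le.2 ht)
  have h2 : |a| / 2 - b ≤ |a / 2 + b * t| := by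
    have := abs_sub_abs_le_abs_sub (a / 2) (-(b * t))
    rw [abs_neg, sub_neg_eq_add, abs_div, abs_two] at this
    linarith
  refine mul_le_mul_of_nonneg_left (Real.exp_le_exp.2 ?_) (by norm_num)
  linarith [mul_le_mul_of_nonneg_left h2 hβ]

lemma abs_sFun_lamXX_sub_le {g : ℝ → ℝ} {K γ β a b : ℝ} (hK : 0 ≤ K) (hγ0 : 0 ≤ γ)
    (hg : ∀ x ∈ Set.Ioo (-1 : ℝ) 1, DifferentiableAt ℝ g x ∧
      |deriv g x| ≤ K * (1 - x ^ 2) ^ (γ - 1)) (hβ : 0 ≤ β) (hb : 0 < b) (θ φ : ℝ) :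
    |g (lamXX β a b θ) - g (lamXX β a b φ)| ≤
      K * (4 * Real.exp (-(β * (|a| - 2 * b)))) ^ γ * (β * b) *
        |Real.cos θ - Real.cos φ| := by
  have hd : ∀ t ∈ Set.Icc (-1 : ℝ) 1,
      HasDerivWithinAt (fun t => g (-Real.tanh (β * (a / 2 + b * t))))
        (deriv g (-Real.tanh (β * (a / 2 + b * t))) *
          (-((1 - Real.tanh (β * (a / 2 + b * t)) ^ 2) * (β * b)))) (Set.Icc (-1) 1) t := by
    intro t _
    have h1 : HasDerivAt (fun t : ℝ => β * (a / 2 + b * t)) (β * b) t := by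
      simpa using (((hasDerivAt_id t).const_mul b).const_add (a / 2)).const_mul β
    have h2 := ((hasDerivAt_tanh (β * (a / 2 + b * t))).comp t h1).neg
    have hmem : -Real.tanh (β * (a / 2 + b * t)) ∈ Set.Ioo (-1 : ℝ) 1 :=
      ⟨by linarith [Real.tanh_lt_one (β * (a / 2 + b * t))],
        by linarith [Real.neg_one_lt_tanh (β * (a / 2 + b * t))]⟩
    exact ((hg _ hmem).1.hasDerivAt.comp t h2).hasDerivWithinAt
  refine (convex_Icc (-1 : ℝ) 1).norm_image_sub_le_of_norm_hasDerivWithin_le hd ?_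
    (Real.cos_mem_Icc φ) (Real.cos_mem_Icc θ)
  intro t ht
  have hW := one_sub_tanh_sq_le_of_gapped (a := a) hβ hb ht
  set T := Real.tanh (β * (a / 2 + b * t)) with hT
  have hT1 : 0 < 1 - T ^ 2 := by linarith [Real.tanh_sq_lt_one (β * (a / 2 + b * t))]
  have hmem : -T ∈ Set.Ioo (-1 : ℝ) 1 :=
    ⟨by linarith [Real.tanh_lt_one (β * (a / 2 + b * t))],
      by linarith [Real.neg_one_lt_tanh (β * (a / 2 + b * t))]⟩
  have h := (hg _ hmem).2
  rw [neg_sq] at h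
  rw [Real.norm_eq_abs, abs_mul, abs_neg, abs_of_nonneg (by positivity : 0 ≤ (1 - T ^ 2) * (β * b))]
  calc |deriv g (-T)| * ((1 - T ^ 2) * (β * b))
      ≤ K * (1 - T ^ 2) ^ (γ - 1) * ((1 - T ^ 2) * (β * b)) := by gcongr
    _ = K * (1 - T ^ 2) ^ γ * (β * b) := by
        rw [Real.rpow_sub_one hT1.ne']
        field_simp
    _ ≤ _ := by gcongr

lemma abs_sin_div_tan_le_one (x : ℝ) : |Real.sin x / Real.tan x| ≤ 1 := by
  by_cases hs : Real.sin x = 0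
  · simp [hs]
  · rw [Real.tan_eq_sin_div_cos, div_div_cancel₀ hs]
    exact Real.abs_cos_le_one x

lemma abs_div_tan_le {x C y : ℝ} (hC : 0 ≤ C) (h : |y| ≤ C * |Real.sin x|) :
    |y / Real.tan x| ≤ C := by
  rw [abs_div]
  calc |y| / |Real.tan x| ≤ C * |Real.sin x| / |Real.tan x| := by gcongr
    _ = C * |Real.sin x / Real.tan x| := by rw [abs_div, mul_div_assoc]
    _ ≤ C := mul_le_of_le_one_right hC (abs_sin_div_tan_le_one x)

lemma abs_sin_sub_sin_le_two_mul_abs_sin (x y : ℝ) :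
    |Real.sin x - Real.sin y| ≤ 2 * |Real.sin ((x - y) / 2)| := by
  rw [Real.sin_sub_sin, abs_mul, abs_mul, abs_two]
  exact mul_le_of_le_one_right (by positivity) (Real.abs_cos_le_one _)

lemma abs_cos_sub_cos_le_two_mul_abs_sin (x y : ℝ) :
    |Real.cos x - Real.cos y| ≤ 2 * |Real.sin ((x - y) / 2)| := by
  rw [Real.cos_sub_cos, abs_mul, abs_mul, abs_neg, abs_two]
  nlinarith [Real.abs_sin_le_one ((x + y) / 2), abs_nonneg (Real.sin ((x - y) / 2))]

lemma abs_dq_mul_deriv_sub_le {g : ℝ → ℝ} {K γ β a b : ℝ} (hK : 0 ≤ K) (hγ0 : 0 ≤ γ) (hγ : γ < 1)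
    (hg : ∀ x ∈ Set.Ioo (-1 : ℝ) 1, DifferentiableAt ℝ g x ∧
      |deriv g x| ≤ K * (1 - x ^ 2) ^ (γ - 1)) (hβ : 0 ≤ β) (hb : 0 < b) (θ φ : ℝ) :
    |dq g (lamXX β a b θ) (lamXX β a b φ) *
        (deriv (lamXX β a b) φ - deriv (lamXX β a b) θ)| ≤
      K * (4 * Real.exp (-(β * (|a| - 2 * b)))) ^ γ * (2 * (β * b) + 4 * (β * b) ^ 2) *
        |Real.sin ((φ - θ) / 2)| := by
  rw [(hasDerivAt_lamXX β a b φ).deriv, (hasDerivAt_lamXX β a b θ).deriv]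
  have hpos : ∀ t, 0 < 1 - lamXX β a b t ^ 2 := fun t => by
    rw [lamXX, neg_sq]
    linarith [Real.tanh_sq_lt_one (β * (a / 2 + b * Real.cos t))]
  have hle : ∀ t, 1 - lamXX β a b t ^ 2 ≤ 4 * Real.exp (-(β * (|a| - 2 * b))) := fun t => by
    rw [lamXX, neg_sq]
    exact one_sub_tanh_sq_le_of_gapped hβ hb (Real.cos_mem_Icc t)
  have hS := abs_sFun_lamXX_sub_le (a := a) hK hγ0 hg hβ hb θ φ
  have hsin := abs_sin_sub_sin_le_two_mul_abs_sin φ θ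
  have hcos := abs_cos_sub_cos_le_two_mul_abs_sin φ θ
  rw [abs_sub_comm (Real.cos φ)] at hcos
  rw [← abs_dq_mul_sub] at hS
  have hwu := hpos θ
  have hwv := hpos φ
  have hWu := hle θ
  have hWv := hle φ
  set W := 4 * Real.exp (-(β * (|a| - 2 * b))) with hW
  set u := lamXX β a b θ
  set v := lamXX β a b φ
  set D := dq g u v with hD
  set s := |Real.sin ((φ - θ) / 2)| with hs
  have hs0 : 0 ≤ s := abs_nonneg _
  have hB : 0 ≤ β * b := by positivity
  have hmin : ∀ w, 0 < w → w ≤ 1 - u ^ 2 → w ≤ 1 - v ^ 2 → |D| * w ≤ K * W ^ γ := by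
    intro w hw h1 h2
    calc |D| * w ≤ K * w ^ (γ - 1) * w := by gcongr; exact abs_dq_le hK hγ hg hw h1 h2
      _ = K * w ^ γ := by rw [Real.rpow_sub_one hw.ne']; field_simp
      _ ≤ K * W ^ γ := by gcongr; linarith
  have hdiff : |D * (u ^ 2 - v ^ 2)| ≤ 4 * (β * b) * (K * W ^ γ) * s := by
    have huv : |u + v| ≤ 2 := by
      have h1 := abs_lt.1 ((sq_lt_one_iff_abs_lt_one u).1 (by linarith))
      have h2 := abs_lt.1 ((sq_lt_one_iff_abs_lt_one v).1 (by linarith))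
      exact abs_le.2 ⟨by linarith, by linarith⟩
    rw [show D * (u ^ 2 - v ^ 2) = D * (u - v) * (u + v) by ring, abs_mul]
    calc |D * (u - v)| * |u + v| ≤ (K * W ^ γ * (β * b) * (2 * s)) * 2 := by
          gcongr
          exact hS.trans (by gcongr)
      _ = _ := by ring
  have hmain : ∀ w t, 0 < w → w ≤ 1 - u ^ 2 → w ≤ 1 - v ^ 2 →
      |β * b * (D * w * (Real.sin φ - Real.sin θ) + Real.sin t * (D * (u ^ 2 - v ^ 2)))| ≤
        K * W ^ γ * (2 * (β * b) + 4 * (β * b) ^ 2) * s := by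
    intro w t hw h1 h2
    rw [abs_mul, abs_of_nonneg hB]
    have e1 : |D * w * (Real.sin φ - Real.sin θ)| ≤ K * W ^ γ * (2 * s) := by
      rw [abs_mul, abs_mul, abs_of_pos hw]
      exact mul_le_mul (hmin w hw h1 h2) hsin (abs_nonneg _) (by positivity)
    have e2 : |Real.sin t * (D * (u ^ 2 - v ^ 2))| ≤ 4 * (β * b) * (K * W ^ γ) * s := by
      rw [abs_mul]
      exact (mul_le_of_le_one_left (abs_nonneg _) (Real.abs_sin_le_one t)).trans hdiff
    calc _ ≤ β * b * (K * W ^ γ * (2 * s) + 4 * (β * b) * (K * W ^ γ) * s) := by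
          gcongr
          exact (abs_add_le _ _).trans (add_le_add e1 e2)
      _ = _ := by ring
  rcases le_total (1 - u ^ 2) (1 - v ^ 2) with h | h
  · refine le_trans (le_of_eq ?_) (hmain (1 - u ^ 2) φ hwu le_rfl h)
    congr 1
    ring
  · refine le_trans (le_of_eq ?_) (hmain (1 - v ^ 2) θ hwv h le_rfl)
    congr 1
    ring

lemma abs_IalphaInf_le {K γ α β a b : ℝ} (hK : 0 ≤ K) (hγ0 : 0 ≤ γ) (hγ : γ < 1)
    (hg : ∀ x ∈ Set.Ioo (-1 : ℝ) 1, DifferentiableAt ℝ (sFun α) x ∧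
      |deriv (sFun α) x| ≤ K * (1 - x ^ 2) ^ (γ - 1)) (hβ : 0 ≤ β) (hb : 0 < b) :
    |IalphaInf α a b β| ≤
      K * (4 * Real.exp (-(β * (|a| - 2 * b)))) ^ γ * (2 * (β * b) + 4 * (β * b) ^ 2) := by
  set C := K * (4 * Real.exp (-(β * (|a| - 2 * b)))) ^ γ * (2 * (β * b) + 4 * (β * b) ^ 2) with hC
  have hC0 : 0 ≤ C := by positivity
  have hlen : |π - -π| = 2 * π := by
    rw [abs_of_nonneg (by linarith [Real.pi_pos])]
    ring
  have hint : |∫ φ in (-π)..π, ∫ θ in (-π)..π,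
      dq (sFun α) (lamXX β a b θ) (lamXX β a b φ) *
        ((deriv (lamXX β a b) φ - deriv (lamXX β a b) θ) / Real.tan ((φ - θ) / 2))| ≤
      C * (2 * π) * (2 * π) := by
    rw [← hlen, ← Real.norm_eq_abs]
    refine intervalIntegral.norm_integral_le_of_norm_le_const fun φ _ => ?_
    refine intervalIntegral.norm_integral_le_of_norm_le_const fun θ _ => ?_
    rw [← mul_div_assoc]
    exact abs_div_tan_le hC0 (abs_dq_mul_deriv_sub_le hK hγ0 hγ hg hβ hb θ φ)
  rw [IalphaInf, abs_mul, abs_of_pos (by positivity : 0 < 1 / (4 * π ^ 2))]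
  calc _ ≤ 1 / (4 * π ^ 2) * (C * (2 * π) * (2 * π)) := by gcongr
    _ = C := by field_simp; ring

/-- **Low-temperature asymptotics in the gapped phase `|a| > 2b`** (Theorem 4, Eq. (51)):
the mutual information decays exponentially, at any rate `κ < (|a| - 2b)·min{α,1}`. -/
theorem xx_low_temperature_gapped (a b α : ℝ) (hb : 0 < b) (ha : 2 * b < |a|)
    (hα : 0 < α) (κ : ℝ) (hκ : κ < (|a| - 2 * b) * min α 1) :
    Tendsto (fun β : ℝ => Real.exp (κ * β) * IalphaInf α a b β) atTop (nhds 0) := by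
  have hΔ : 0 < |a| - 2 * b := by linarith
  obtain ⟨γ, hγl, hγu⟩ : ∃ γ, max 0 (κ / (|a| - 2 * b)) < γ ∧ γ < min α 1 :=
    exists_between (max_lt (lt_min hα one_pos) ((div_lt_iff₀' hΔ).2 hκ))
  have hγ0 : 0 < γ := (le_max_left _ _).trans_lt hγl
  have hγκ : κ < (|a| - 2 * b) * γ := (div_lt_iff₀' hΔ).1 ((le_max_right _ _).trans_lt hγl)
  have hγ1 : γ < 1 := hγu.trans_le (min_le_right _ _)
  obtain ⟨K, hK, hg⟩ := exists_deriv_sFun_bound hα (hγu.le.trans (min_le_left _ _)) hγ1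
  set c := (|a| - 2 * b) * γ - κ with hc
  have hc0 : 0 < c := by linarith
  have hlim : Tendsto (fun β : ℝ => K * 4 ^ γ * (2 * b * (β ^ (1 : ℝ) * Real.exp (-c * β)) +
      4 * b ^ 2 * (β ^ (2 : ℝ) * Real.exp (-c * β)))) atTop (nhds 0) := by
    have h1 := tendsto_rpow_mul_exp_neg_mul_atTop_nhds_zero 1 c hc0
    have h2 := tendsto_rpow_mul_exp_neg_mul_atTop_nhds_zero 2 c hc0
    simpa using ((h1.const_mul (2 * b)).add (h2.const_mul (4 * b ^ 2))).const_mul (K * 4 ^ γ)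
  refine squeeze_zero_norm' ?_ hlim
  filter_upwards [eventually_ge_atTop 0] with β hβ
  rw [norm_mul, Real.norm_eq_abs, Real.norm_eq_abs, Real.abs_exp]
  refine (mul_le_mul_of_nonneg_left (abs_IalphaInf_le hK hγ0.le hγ1 hg hβ hb)
    (Real.exp_pos _).le).trans (le_of_eq ?_)
  have hexp : Real.exp (-c * β) = Real.exp (κ * β) * Real.exp (-(β * (|a| - 2 * b)) * γ) := by
    rw [← Real.exp_add, hc]
    ring_nf
  rw [Real.mul_rpow (by norm_num) (Real.exp_pos _).le, ← Real.exp_mul, hexp, Real.rpow_one,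
    Real.rpow_two]
  ring
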